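/- arXiv:1504.06454 — 5 statements merged into one kernel-verified Lean document; each statement's English description precedes it below -/
import Mathlib

section
/- There exists a finite simple graph that is a disk graph but is not a pairwise compatibility graph (PCG). (Theorem 1, part 1.) -/
/-- `G` is a pairwise compatibility graph: there are a finite tree `T` with nonnegative
edge weights, an injection of the vertices of `G` into the leaves of `T`, and bounds
`0 ≤ dmin ≤ dmax` such that two distinct vertices are adjacent iff the weighted
tree-distance of the corresponding leaves lies in `[dmin, dmax]`. -/
def IsPCG {V : Type} [Fintype V] (G : SimpleGraph V) : Prop :=
  ∃ (n : ℕ) (T : SimpleGraph (Fin n)) (w : Sym2 (Fin n) → ℝ)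
      (f : V → Fin n) (dmin dmax : ℝ),
    T.Connected ∧ T.IsAcyclic ∧
    (∀ e ∈ T.edgeSet, 0 ≤ w e) ∧
    Function.Injective f ∧
    (∀ v : V, ∃! x : Fin n, T.Adj (f v) x) ∧
    0 ≤ dmin ∧ dmin ≤ dmax ∧
    ∀ u v : V, u ≠ v →
      (G.Adj u v ↔ ∃ p : T.Walk (f u) (f v), p.IsPath ∧
        dmin ≤ (p.edges.map w).sum ∧ (p.edges.map w).sum ≤ dmax)

/-- `G` is a disk graph: vertices are represented by closed balls of positive radius in
the Euclidean plane, and two distinct vertices are adjacent iff their balls intersect. -/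
def IsDiskGraph {V : Type} [Fintype V] (G : SimpleGraph V) : Prop :=
  ∃ (c : V → EuclideanSpace ℝ (Fin 2)) (r : V → ℝ),
    (∀ v, 0 < r v) ∧
    ∀ u v : V, u ≠ v →
      (G.Adj u v ↔
        (Metric.closedBall (c u) (r u) ∩ Metric.closedBall (c v) (r v)).Nonempty)

section tree
variable {W : Type} [DecidableEq W] {T : SimpleGraph W}

lemma isPath_append' {u v x : W} {p : T.Walk u v} {q : T.Walk v x} (hp : p.IsPath) (hq : q.IsPath)
    (h : ∀ t ∈ p.support, t ∈ q.support → t = v) : (p.append q).IsPath := by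
  rw [SimpleGraph.Walk.isPath_def] at *
  rw [SimpleGraph.Walk.support_append, List.nodup_append]
  rw [← SimpleGraph.Walk.cons_tail_support q] at hq
  rw [List.nodup_cons] at hq
  refine ⟨hp, hq.2, ?_⟩
  rintro a ha b hb rfl
  have := h a ha (List.mem_of_mem_tail hb)
  subst this
  exact hq.1 hb

noncomputable def tP (hT : T.IsTree) (u v : W) : T.Walk u v := (hT.existsUnique_path u v).choose

lemma tP_isPath (hT : T.IsTree) (u v : W) : (tP hT u v).IsPath :=
  (hT.existsUnique_path u v).choose_spec.1

lemma eq_tP (hT : T.IsTree) {u v : W} (p : T.Walk u v) (hp : p.IsPath) : p = tP hT u v :=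
  (hT.existsUnique_path u v).choose_spec.2 p hp

noncomputable def td (hT : T.IsTree) (w : Sym2 W → ℝ) (u v : W) : ℝ :=
  ((tP hT u v).edges.map w).sum

lemma td_comm (hT : T.IsTree) (w : Sym2 W → ℝ) (u v : W) : td hT w u v = td hT w v u := by
  unfold td
  rw [← eq_tP hT (tP hT u v).reverse (tP_isPath hT u v).reverse]
  simp [SimpleGraph.Walk.edges_reverse, List.sum_reverse]

lemma td_of_mem (hT : T.IsTree) (w : Sym2 W → ℝ) {u v x : W} (h : x ∈ (tP hT u v).support) :
    td hT w u v = td hT w u x + td hT w x v := by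
  have h1 := eq_tP hT _ ((tP_isPath hT u v).takeUntil h)
  have h2 := eq_tP hT _ ((tP_isPath hT u v).dropUntil h)
  have h3 := (tP hT u v).take_spec h
  rw [h1, h2] at h3
  unfold td
  rw [← h3]
  simp [SimpleGraph.Walk.edges_append]

lemma td_triangle (hT : T.IsTree) (w : Sym2 W → ℝ) (hw : ∀ e ∈ T.edgeSet, 0 ≤ w e) (u v x : W) :
    td hT w u v ≤ td hT w u x + td hT w x v := by
  have h1 := eq_tP hT _ (((tP hT u x).append (tP hT x v)).bypass_isPath)
  have h2 := ((tP hT u x).append (tP hT x v)).edges_bypass_sublist_edges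
  rw [h1] at h2
  have h3 := (h2.map w).sum_le_sum (by
    intro a ha
    obtain ⟨e, he, rfl⟩ := List.mem_map.1 ha
    exact hw e (SimpleGraph.Walk.edges_subset_edgeSet _ he))
  rw [SimpleGraph.Walk.edges_append, List.map_append, List.sum_append] at h3
  exact h3

lemma on_trans (hT : T.IsTree) {c v v' x : W} (h : v ∈ (tP hT c v').support)
    (h' : v' ∈ (tP hT c x).support) : v ∈ (tP hT c x).support := by
  rw [← eq_tP hT _ ((tP_isPath hT c x).takeUntil h')] at h
  exact SimpleGraph.Walk.support_takeUntil_subset_support _ _ h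

lemma on_total (hT : T.IsTree) {c v v' a : W} (h : v ∈ (tP hT c a).support)
    (h' : v' ∈ (tP hT c a).support) :
    v ∈ (tP hT c v').support ∨ v' ∈ (tP hT c v).support := by
  by_cases h1 : v ∈ (tP hT c v').support
  · exact Or.inl h1
  right
  have h3 := (tP hT c a).take_spec h'
  have e1 := eq_tP hT _ ((tP_isPath hT c a).takeUntil h')
  have h4 : v ∈ ((tP hT c a).dropUntil v' h').support := by
    rw [← h3, SimpleGraph.Walk.mem_support_append_iff] at h
    rcases h with h | h
    · rw [e1] at h; exact absurd h h1
    · exact h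
  have h5 := ((tP hT c a).dropUntil v' h').take_spec h4
  have hp : (((tP hT c a).takeUntil v' h').append
      (((tP hT c a).dropUntil v' h').takeUntil v h4)).IsPath := by
    have := tP_isPath hT c a
    rw [← h3, ← h5, SimpleGraph.Walk.append_assoc] at this
    exact this.of_append_left
  rw [← eq_tP hT _ hp, SimpleGraph.Walk.mem_support_append_iff]
  left
  exact SimpleGraph.Walk.end_mem_support _

lemma exists_median (hT : T.IsTree) (c a b : W) :
    ∃ v, v ∈ (tP hT a b).support ∧ v ∈ (tP hT c a).support ∧ v ∈ (tP hT c b).support := by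
  obtain ⟨v, hv, hv', h⟩ := (tP hT c a).exists_mem_support_forall_mem_support_imp_eq
    (tP hT a b).support.toFinset ⟨a, by simp⟩
  simp only [List.mem_toFinset] at hv h
  refine ⟨v, hv, hv', ?_⟩
  have hp := isPath_append' ((tP_isPath hT c a).takeUntil hv') ((tP_isPath hT a b).dropUntil hv)
    (fun t ht ht' => h t (SimpleGraph.Walk.support_dropUntil_subset_support _ _ ht') ht)
  rw [← eq_tP hT _ hp, SimpleGraph.Walk.mem_support_append_iff]
  left
  exact SimpleGraph.Walk.end_mem_support _

noncomputable def gl (hT : T.IsTree) (w : Sym2 W → ℝ) (c a b : W) : ℝ :=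
  td hT w c a + td hT w c b - td hT w a b

lemma gl_comm (hT : T.IsTree) (w : Sym2 W → ℝ) (c a b : W) : gl hT w c a b = gl hT w c b a := by
  unfold gl; rw [td_comm hT w a b]; ring

lemma le_gl (hT : T.IsTree) (w : Sym2 W → ℝ) (hw : ∀ e ∈ T.edgeSet, 0 ≤ w e) {c a b v : W}
    (ha : v ∈ (tP hT c a).support) (hb : v ∈ (tP hT c b).support) :
    2 * td hT w c v ≤ gl hT w c a b := by
  have h1 := td_of_mem hT w ha
  have h2 := td_of_mem hT w hb
  have h3 := td_triangle hT w hw a b v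
  rw [td_comm hT w a v] at h3
  unfold gl
  linarith

lemma gl_eq (hT : T.IsTree) (w : Sym2 W → ℝ) {c a b v : W} (h : v ∈ (tP hT a b).support)
    (ha : v ∈ (tP hT c a).support) (hb : v ∈ (tP hT c b).support) :
    gl hT w c a b = 2 * td hT w c v := by
  have h1 := td_of_mem hT w ha
  have h2 := td_of_mem hT w hb
  have h3 := td_of_mem hT w h
  rw [td_comm hT w a v] at h3
  unfold gl
  linarith

lemma gl_ultra (hT : T.IsTree) (w : Sym2 W → ℝ) (hw : ∀ e ∈ T.edgeSet, 0 ≤ w e) (c a b x : W) :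
    min (gl hT w c a b) (gl hT w c a x) ≤ gl hT w c b x := by
  obtain ⟨v, h1, h2, h3⟩ := exists_median hT c a b
  obtain ⟨v', h1', h2', h3'⟩ := exists_median hT c a x
  rcases on_total hT h2 h2' with h | h
  · refine min_le_of_left_le ?_
    rw [gl_eq hT w h1 h2 h3]
    exact le_gl hT w hw h3 (on_trans hT h h3')
  · refine min_le_of_right_le ?_
    rw [gl_eq hT w h1' h2' h3']
    exact le_gl hT w hw (on_trans hT h h3) h3'

end tree

lemma inj3 {α : Type} (a b c : α) (h1 : a ≠ b) (h2 : a ≠ c) (h3 : b ≠ c) :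
    Function.Injective ![a, b, c] := by
  intro x y hxy
  fin_cases x <;> fin_cases y <;> simp_all

abbrev GV := Fin 13 × Fin 5

def gAdj (p q : GV) : Prop :=
  ((p.1.val : ℤ) - q.1.val) ^ 2 + ((p.2.val : ℤ) - q.2.val) ^ 2 ≤ 1

def rw2 (s : Fin 7) : Fin 13 := ⟨2 * s.val, by omega⟩

open Classical in
noncomputable def wt (Q : Finset GV) : ℕ :=
  ∑ s : Fin 7, ∑ j : Fin 5, if ((rw2 s, j) : GV) ∈ Q then 1 else 0

def Good (l : GV → GV → ℝ) (Q : Finset GV) : Prop :=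
  ∀ o, o ∉ Q → ∀ p ∈ Q, ∀ q ∈ Q, l p o = l q o

lemma wt_split (P Q : Finset GV) (h : P ⊆ Q) : wt Q = wt P + wt (Q \ P) := by
  classical
  unfold wt
  rw [← Finset.sum_add_distrib]
  refine Finset.sum_congr rfl fun s _ => ?_
  rw [← Finset.sum_add_distrib]
  refine Finset.sum_congr rfl fun j _ => ?_
  have := @h (rw2 s, j)
  by_cases h1 : ((rw2 s, j) : GV) ∈ P
  · simp [h1, this h1]
  · simp [h1]

lemma exists_balanced (l : GV → GV → ℝ) (hs : ∀ a b, l a b = l b a)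
    (hu : ∀ a b x, min (l a b) (l a x) ≤ l b x) (Q : Finset GV) :
    Good l Q → 12 ≤ wt Q → ∃ Q', Good l Q' ∧ 12 ≤ wt Q' ∧ wt Q' ≤ 23 := by
  classical
  induction Q using Finset.strongInduction with
  | H Q ih =>
    intro hg hw
    by_cases h24 : wt Q ≤ 23
    · exact ⟨Q, hg, hw, h24⟩
    push Not at h24
    have hne : Q.offDiag.Nonempty := by
      rw [← Finset.card_pos, Finset.offDiag_card]
      by_contra hcon
      have hc1 : Q.card ≤ 1 := by
        by_contra h2
        push Not at h2
        apply hcon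
        have : Q.card * 1 < Q.card * Q.card := by
          apply Nat.mul_lt_mul_of_pos_left h2; omega
        omega
      have : wt Q ≤ 1 := by
        unfold wt
        rw [← Finset.sum_product', ← Finset.card_filter]
        refine le_trans (Finset.card_le_card_of_injOn (fun x : Fin 7 × Fin 5 => ((rw2 x.1, x.2) : GV)) ?_ ?_) hc1
        · intro x hx
          simpa using hx
        · rintro ⟨s, j⟩ _ ⟨s', j'⟩ _ h
          simp only [rw2, Prod.mk.injEq, Fin.mk.injEq] at h
          ext <;> simp <;> omega
      omega
    obtain ⟨⟨a, b⟩, hab, hmin⟩ := Finset.exists_min_image Q.offDiag (fun x => l x.1 x.2) hne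
    rw [Finset.mem_offDiag] at hab
    obtain ⟨ha, hb, hne⟩ := hab
    simp only at ha hb hne
    have hmin' : ∀ x ∈ Q, ∀ y ∈ Q, x ≠ y → l a b ≤ l x y := fun x hx y hy hxy =>
      hmin (x, y) (by rw [Finset.mem_offDiag]; exact ⟨hx, hy, hxy⟩)
    set P := Q.filter (fun x => x = a ∨ l a b < l a x) with hP
    have hPQ : P ⊆ Q := Finset.filter_subset _ _
    have haP : a ∈ P := by simp [hP, ha]
    have hbP : b ∉ P := by simp [hP, Ne.symm hne]
    have key : ∀ p ∈ P, ∀ x ∈ Q \ P, l p x = l a b := by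
      intro p hp x hx
      rw [Finset.mem_sdiff] at hx
      obtain ⟨hxQ, hxP⟩ := hx
      have hpx : p ≠ x := fun h => hxP (h ▸ hp)
      have hpQ := hPQ hp
      have hxa : x ≠ a ∧ l a x ≤ l a b := by
        have : ¬ (x = a ∨ l a b < l a x) := fun h => hxP (by simp [hP, hxQ, h])
        push Not at this; exact this
      have h1 := hmin' p hpQ x hxQ hpx
      rcases (Finset.mem_filter.1 hp).2 with h | h
      · subst h; exact le_antisymm hxa.2 h1
      · have h2 := hu p a x
        rw [hs p a] at h2
        rcases min_le_iff.1 h2 with h3 | h3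
        · linarith
        · linarith
    have gP : Good l P := by
      intro o ho p hp q hq
      by_cases hoQ : o ∈ Q
      · rw [key p hp o (by simp [hoQ, ho]), key q hq o (by simp [hoQ, ho])]
      · exact hg o hoQ p (hPQ hp) q (hPQ hq)
    have gP' : Good l (Q \ P) := by
      intro o ho p hp q hq
      by_cases hoQ : o ∈ Q
      · have hoP : o ∈ P := by
          by_contra h
          exact ho (by simp [hoQ, h])
        rw [hs p, hs q, key o hoP p hp, key o hoP q hq]
      · exact hg o hoQ p (Finset.sdiff_subset hp) q (Finset.sdiff_subset hq)
    have hsum := wt_split P Q hPQ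
    by_cases h12 : 12 ≤ wt P
    · refine ih P ?_ gP h12
      exact (Finset.ssubset_iff_of_subset hPQ).2 ⟨b, hb, hbP⟩
    · refine ih (Q \ P) ?_ gP' (by omega)
      exact (Finset.ssubset_iff_of_subset Finset.sdiff_subset).2 ⟨a, ha, by simp [haP]⟩

lemma no3K2 (m M : ℝ) (D : Fin 3 → ℝ) (k : Fin 3 → ℝ)
    (hD : ∀ i, m ≤ D i ∧ D i ≤ M) (h1 : ∀ i, m ≤ D i + k i ∧ D i + k i ≤ M)
    (h2 : ∀ i j, i ≠ j → ¬ (m ≤ D i + k j ∧ D i + k j ≤ M)) : False := by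
  have hpos : ∀ i j, i ≠ j → 0 ≤ k i → 0 ≤ k j → False := by
    intro i j hij hi hj
    have a1 := h2 i j hij
    have a2 := h2 j i (Ne.symm hij)
    have b1 := h1 i; have b2 := h1 j; have c1 := hD i; have c2 := hD j
    apply a1; refine ⟨by linarith, ?_⟩
    by_contra h
    apply a2; exact ⟨by linarith, by linarith⟩
  have hneg : ∀ i j, i ≠ j → k i < 0 → k j < 0 → False := by
    intro i j hij hi hj
    have a1 := h2 i j hij
    have a2 := h2 j i (Ne.symm hij)
    have b1 := h1 i; have b2 := h1 j; have c1 := hD i; have c2 := hD j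
    apply a1; refine ⟨?_, by linarith⟩
    by_contra h
    apply a2; exact ⟨by linarith, by linarith⟩
  rcases le_or_gt 0 (k 0) with x | x <;> rcases le_or_gt 0 (k 1) with y | y <;>
    rcases le_or_gt 0 (k 2) with z | z <;>
    first
    | exact hpos 0 1 (by decide) x y
    | exact hpos 0 2 (by decide) x z
    | exact hpos 1 2 (by decide) y z
    | exact hneg 0 1 (by decide) x y
    | exact hneg 0 2 (by decide) x z
    | exact hneg 1 2 (by decide) y z

/-- a non-constant predicate on an initial segment of ℕ changes between consecutive values. -/
lemma exists_change (n : ℕ) (p : Fin n → Prop) (i j : Fin n) (hi : p i) (hj : ¬ p j) :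
    ∃ a b : Fin n, p a ∧ ¬ p b ∧ ((a.val : ℤ) - b.val) ^ 2 = 1 := by
  by_contra hcon
  push Not at hcon
  have step : ∀ k : ℕ, ∀ h : k + 1 < n, (p ⟨k, by omega⟩ ↔ p ⟨k + 1, h⟩) := by
    intro k h
    constructor
    · intro h1
      by_contra h2
      exact hcon _ _ h1 h2 (by push_cast; ring)
    · intro h1
      by_contra h2
      exact hcon _ _ h1 h2 (by push_cast; ring)
  have all : ∀ k : ℕ, ∀ h : k < n, (p ⟨0, by omega⟩ ↔ p ⟨k, h⟩) := by
    intro k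
    induction k with
    | zero => intro h; rfl
    | succ k ih => intro h; rw [ih (by omega)]; exact step k h
  exact hj ((all j.val j.isLt).1 ((all i.val i.isLt).2 hi))

set_option maxHeartbeats 1000000 in
lemma core (l : GV → GV → ℝ) (D : GV → ℝ) (m M : ℝ) (hs : ∀ a b, l a b = l b a)
    (hu : ∀ a b x, min (l a b) (l a x) ≤ l b x) (hD : ∀ a, m ≤ D a ∧ D a ≤ M)
    (hadj : ∀ a b, a ≠ b → (gAdj a b ↔ m ≤ D a + D b - l a b ∧ D a + D b - l a b ≤ M)) :
    False := by
  classical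
  have huniv : 12 ≤ wt Finset.univ := by simp [wt]
  obtain ⟨Q, hg, h12, h23⟩ := exists_balanced l hs hu Finset.univ
    (fun o ho => absurd (Finset.mem_univ o) ho) huniv
  have no3 : ∀ a o : Fin 3 → GV, (∀ i, a i ∈ Q) → (∀ i, o i ∉ Q) → (∀ i, gAdj (a i) (o i)) →
      (∀ i j, i ≠ j → ¬ gAdj (a i) (o j)) → False := by
    intro a o ha ho h1 h2
    have hne : ∀ i j, a i ≠ o j := fun i j h => ho j (h ▸ ha i)
    have hl : ∀ i j, l (a i) (o j) = l (a 0) (o j) := fun i j => hg _ (ho j) _ (ha i) _ (ha 0)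
    refine no3K2 m M (fun i => D (a i)) (fun j => D (o j) - l (a 0) (o j)) (fun i => hD _) ?_ ?_
    · intro i
      have := (hadj _ _ (hne i i)).1 (h1 i)
      rw [hl i i] at this
      simpa [add_sub_assoc] using this
    · intro i j hij
      have := mt (hadj _ _ (hne i j)).2 (h2 i j hij)
      rw [hl i j] at this
      simpa [add_sub_assoc] using this
  -- rows
  have rows : ∀ s : Fin 3 → Fin 7, Function.Injective s →
      (∀ i, ∃ j j', (rw2 (s i), j) ∈ Q ∧ (rw2 (s i), j') ∉ Q) → False := by
    intro s hinj h
    have : ∀ i, ∃ j j' : Fin 5, (rw2 (s i), j) ∈ Q ∧ (rw2 (s i), j') ∉ Q ∧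
        ((j.val : ℤ) - j'.val) ^ 2 = 1 := by
      intro i
      obtain ⟨j, j', h1, h2⟩ := h i
      exact exists_change 5 (fun j => (rw2 (s i), j) ∈ Q) j j' h1 h2
    choose j j' h1 h2 h3 using this
    refine no3 (fun i => (rw2 (s i), j i)) (fun i => (rw2 (s i), j' i)) h1 h2 ?_ ?_
    · intro i
      simp [gAdj, h3 i]
    · intro i k hik hc
      have hne : (s i).val ≠ (s k).val := fun h => hik (hinj (Fin.ext h))
      simp only [gAdj, rw2] at hc
      push_cast at hc
      have h5 : (((s i).val : ℤ) - (s k).val) ≠ 0 := by omega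
      have h6 := Int.one_le_abs h5
      have h7 : 1 ≤ (((s i).val : ℤ) - (s k).val) ^ 2 := by rw [← sq_abs]; nlinarith
      nlinarith [sq_nonneg (((j i).val : ℤ) - (j' k).val)]
  have cols : (∀ j : Fin 5, ∃ i i', (i, j) ∈ Q ∧ (i', j) ∉ Q) → False := by
    intro h
    let t : Fin 3 → Fin 5 := fun i => ⟨2 * i.val, by omega⟩
    have : ∀ k, ∃ i i' : Fin 13, (i, t k) ∈ Q ∧ (i', t k) ∉ Q ∧
        ((i.val : ℤ) - i'.val) ^ 2 = 1 := by
      intro k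
      obtain ⟨j, j', h1, h2⟩ := h (t k)
      exact exists_change 13 (fun j => (j, t k) ∈ Q) j j' h1 h2
    choose j j' h1 h2 h3 using this
    refine no3 (fun i => (j i, t i)) (fun i => (j' i, t i)) h1 h2 ?_ ?_
    · intro i
      simp [gAdj, h3 i]
    · intro i k hik hc
      have hne : i.val ≠ k.val := fun h => hik (Fin.ext h)
      simp only [gAdj, t] at hc
      push_cast at hc
      have h5 : ((i.val : ℤ) - k.val) ≠ 0 := by omega
      have h6 := Int.one_le_abs h5
      have h7 : 1 ≤ ((i.val : ℤ) - k.val) ^ 2 := by rw [← sq_abs]; nlinarith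
      nlinarith [sq_nonneg (((j i).val : ℤ) - (j' k).val)]
  let q : Fin 7 → ℕ := fun s => ∑ j : Fin 5, if ((rw2 s, j) : GV) ∈ Q then 1 else 0
  have hwq : wt Q = ∑ s, q s := rfl
  have hq5 : ∀ s, q s ≤ 5 := by
    intro s
    calc q s ≤ ∑ j : Fin 5, 1 := Finset.sum_le_sum fun j _ => by split_ifs <;> simp
      _ = 5 := by simp
  let mixed : Fin 7 → Prop := fun s => ∃ j j', (rw2 s, j) ∈ Q ∧ (rw2 s, j') ∉ Q
  have hcard : (Finset.univ.filter mixed).card ≤ 2 := by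
    by_contra h
    push Not at h
    obtain ⟨a, b, c, ha, hb, hc, hab, hac, hbc⟩ := Finset.two_lt_card_iff.1 h
    simp only [Finset.mem_filter, Finset.mem_univ, true_and] at ha hb hc
    refine rows ![a, b, c] (inj3 a b c hab hac hbc) ?_
    intro i
    fin_cases i
    · exact ha
    · exact hb
    · exact hc
  by_cases hfull : ∃ s, ∀ j, (rw2 s, j) ∈ Q
  · obtain ⟨s, hsf⟩ := hfull
    have hnone : ∀ s', ¬ ∀ j, (rw2 s', j) ∉ Q := by
      intro s' hs'
      exact cols fun j => ⟨rw2 s, rw2 s', hsf j, hs' j⟩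
    have hpure : ∀ s, ¬ mixed s → q s = 5 := by
      intro s hm
      have hall : ∀ j, (rw2 s, j) ∈ Q := by
        have := hnone s
        push Not at this
        obtain ⟨j, hj⟩ := this
        intro j'
        by_contra h
        exact hm ⟨j, j', hj, h⟩
      simp [q, hall]
    have : ∑ s, (5 - q s) ≤ 10 := by
      calc ∑ s, (5 - q s) ≤ ∑ s, (if mixed s then 5 else 0) := by
            refine Finset.sum_le_sum fun s _ => ?_
            split_ifs with h
            · omega
            · simp [hpure s h]
        _ = 5 * (Finset.univ.filter mixed).card := by
            rw [← Finset.sum_filter]; simp [mul_comm]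
        _ ≤ 10 := by omega
    have h35 : ∑ s, (5 - q s) + ∑ s, q s = 35 := by
      rw [← Finset.sum_add_distrib]
      calc ∑ s, (5 - q s + q s) = ∑ s : Fin 7, 5 :=
            Finset.sum_congr rfl fun s _ => by have := hq5 s; omega
        _ = 35 := by simp
    omega
  · push Not at hfull
    have hpure : ∀ s, ¬ mixed s → q s = 0 := by
      intro s hm
      have hall : ∀ j, (rw2 s, j) ∉ Q := by
        obtain ⟨j, hj⟩ := hfull s
        intro j' h
        exact hm ⟨j', j, h, hj⟩
      simp [q, hall]
    have : ∑ s, q s ≤ 10 := by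
      calc ∑ s, q s ≤ ∑ s, (if mixed s then 5 else 0) := by
            refine Finset.sum_le_sum fun s _ => ?_
            split_ifs with h
            · exact hq5 s
            · simp [hpure s h]
        _ = 5 * (Finset.univ.filter mixed).card := by
            rw [← Finset.sum_filter]; simp [mul_comm]
        _ ≤ 10 := by omega
    omega

/-- the grid together with a universal vertex -/
def gridCone : SimpleGraph (Option GV) where
  Adj u v := u ≠ v ∧ ∀ p q, u = some p → v = some q → gAdj p q
  symm := ⟨by
    rintro u v ⟨h1, h2⟩
    refine ⟨h1.symm, fun p q hp hq => ?_⟩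
    have := h2 q p hq hp
    unfold gAdj at *
    linarith⟩
  loopless := ⟨fun u h => h.1 rfl⟩

lemma balls_iff (x y x' y' r r' : ℝ) (hr : 0 < r) (hr' : 0 < r') :
    (Metric.closedBall (!₂[x, y] : EuclideanSpace ℝ (Fin 2)) r ∩
      Metric.closedBall (!₂[x', y'] : EuclideanSpace ℝ (Fin 2)) r').Nonempty ↔
      (x - x') ^ 2 + (y - y') ^ 2 ≤ (r + r') ^ 2 := by
  rw [← Set.not_disjoint_iff_nonempty_inter, disjoint_closedBall_closedBall_iff hr.le hr'.le,
    not_lt, EuclideanSpace.dist_eq, Real.sqrt_le_left (by positivity)]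
  simp [Fin.sum_univ_two, Real.dist_eq, sq_abs]

lemma gridCone_disk : IsDiskGraph gridCone := by
  refine ⟨fun v => match v with
    | none => !₂[0, 0]
    | some p => !₂[(p.1.val : ℝ), (p.2.val : ℝ)],
    fun v => match v with
    | none => 100
    | some _ => 1 / 2, ?_, ?_⟩
  · rintro (_ | _) <;> norm_num
  · have bd : ∀ p : GV, (p.1.val : ℝ) ^ 2 + (p.2.val : ℝ) ^ 2 ≤ 1000 := by
      intro p
      have h1 : (p.1.val : ℝ) ≤ 13 := by exact_mod_cast p.1.isLt.le
      have h2 : (p.2.val : ℝ) ≤ 5 := by exact_mod_cast p.2.isLt.le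
      have h3 : (0 : ℝ) ≤ p.1.val := by positivity
      have h4 : (0 : ℝ) ≤ p.2.val := by positivity
      nlinarith
    rintro (_ | p) (_ | q) huv
    · exact absurd rfl huv
    · simp only
      rw [balls_iff _ _ _ _ _ _ (by norm_num) (by norm_num)]
      have := bd q
      refine iff_of_true ⟨huv, fun p q hp => by simp at hp⟩ (by nlinarith)
    · simp only
      rw [balls_iff _ _ _ _ _ _ (by norm_num) (by norm_num)]
      have := bd p
      refine iff_of_true ⟨huv, fun p q hp hq => by simp at hq⟩ (by nlinarith)
    · simp only
      rw [balls_iff _ _ _ _ _ _ (by norm_num) (by norm_num)]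
      have : gridCone.Adj (some p) (some q) ↔ gAdj p q := by
        constructor
        · intro h; exact h.2 p q rfl rfl
        · intro h
          refine ⟨huv, fun p' q' hp hq => ?_⟩
          cases hp; cases hq; exact h
      rw [this, gAdj]
      norm_num
      exact_mod_cast Iff.rfl

lemma gridCone_not_PCG : ¬ IsPCG gridCone := by
  rintro ⟨n, T, w, f, m, M, hc, ha, hw, hf, -, -, -, h⟩
  have hT : T.IsTree := ⟨hc, ha⟩
  have h' : ∀ u v, u ≠ v → (gridCone.Adj u v ↔ m ≤ td hT w (f u) (f v) ∧ td hT w (f u) (f v) ≤ M) := by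
    intro u v huv
    rw [h u v huv]
    constructor
    · rintro ⟨p, hp, h1⟩
      rw [eq_tP hT p hp] at h1
      exact h1
    · intro h1
      exact ⟨tP hT _ _, tP_isPath hT _ _, h1⟩
  refine core (fun a b => gl hT w (f none) (f (some a)) (f (some b)))
    (fun a => td hT w (f none) (f (some a))) m M (fun a b => gl_comm hT w _ _ _)
    (fun a b x => gl_ultra hT w hw _ _ _ _) ?_ ?_
  · intro a
    exact (h' none (some a) (by simp)).1 ⟨by simp, fun p q hp => by simp at hp⟩
  · intro p q hpq
    have hne : (some p : Option GV) ≠ some q := by simpa using hpq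
    have : gridCone.Adj (some p) (some q) ↔ gAdj p q := by
      constructor
      · intro h; exact h.2 p q rfl rfl
      · intro h
        refine ⟨hne, fun p' q' hp hq => ?_⟩
        cases hp; cases hq; exact h
    rw [← this, h' _ _ hne]
    simp [gl]

/-- There exists a finite simple graph that is a disk graph but is not a
pairwise compatibility graph. -/
theorem exists_DiskGraph_not_PCG :
    ∃ (n : ℕ) (G : SimpleGraph (Fin n)), IsDiskGraph G ∧ ¬ IsPCG G := by
  let e := Fintype.equivFin (Option GV)
  refine ⟨_, gridCone.comap e.symm, ?_, ?_⟩
  · obtain ⟨c, r, hr, h⟩ := gridCone_disk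
    refine ⟨c ∘ e.symm, r ∘ e.symm, fun v => hr _, fun u v huv => ?_⟩
    exact h _ _ (fun h => huv (e.symm.injective h))
  · rintro ⟨n, T, w, f, m, M, hc, ha, hw, hf, hl, h0, h1, h⟩
    refine gridCone_not_PCG ⟨n, T, w, f ∘ e, m, M, hc, ha, hw, hf.comp e.injective,
      fun v => hl _, h0, h1, fun u v huv => ?_⟩
    have := h (e u) (e v) (fun h => huv (e.injective h))
    refine Iff.trans ?_ this
    simp
end

section
/- There exists a finite simple graph that is a grid intersection graph but is not a pairwise compatibility graph (PCG). (Theorem 1, part 2.) -/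
/-- `G` is a grid intersection graph: vertices are represented by nondegenerate
horizontal or vertical closed segments in the plane, and two distinct vertices are
adjacent iff their segments intersect. -/
def IsGridIntersectionGraph {V : Type} [Fintype V] (G : SimpleGraph V) : Prop :=
  ∃ p q : V → ℝ × ℝ,
    (∀ v, p v ≠ q v ∧ ((p v).2 = (q v).2 ∨ (p v).1 = (q v).1)) ∧
    ∀ u v : V, u ≠ v →
      (G.Adj u v ↔ (segment ℝ (p u) (q u) ∩ segment ℝ (p v) (q v)).Nonempty)

namespace PCGAux

open SimpleGraph

variable {V : Type} {T : SimpleGraph V}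

/-- Weight of a walk. -/
noncomputable def wt (w : Sym2 V → ℝ) {a b : V} (p : T.Walk a b) : ℝ := (p.edges.map w).sum

lemma wt_append (w : Sym2 V → ℝ) {a b c : V} (p : T.Walk a b) (q : T.Walk b c) :
    wt w (p.append q) = wt w p + wt w q := by
  simp [wt, Walk.edges_append]

lemma wt_reverse (w : Sym2 V → ℝ) {a b : V} (p : T.Walk a b) :
    wt w p.reverse = wt w p := by
  simp [wt, Walk.edges_reverse, List.sum_reverse]

lemma path_eq_bypass [DecidableEq V] (hT : T.IsAcyclic) {a b : V} (p q : T.Walk a b)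
    (hp : p.IsPath) : p = q.bypass := by
  have := hT.path_unique ⟨p, hp⟩ ⟨q.bypass, q.bypass_isPath⟩
  exact congrArg Subtype.val this

lemma edges_sub (hT : T.IsAcyclic) {a b : V} (p q : T.Walk a b) (hp : p.IsPath) :
    p.edges ⊆ q.edges := by
  classical
  rw [path_eq_bypass hT p q hp]
  exact q.edges_bypass_subset

lemma support_sub (hT : T.IsAcyclic) {a b : V} (p q : T.Walk a b) (hp : p.IsPath) :
    p.support ⊆ q.support := by
  classical
  rw [path_eq_bypass hT p q hp]
  exact q.support_bypass_subset

lemma wt_le (hT : T.IsAcyclic) (w : Sym2 V → ℝ) (hw : ∀ e ∈ T.edgeSet, 0 ≤ w e)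
    {a b : V} (p q : T.Walk a b) (hp : p.IsPath) : wt w p ≤ wt w q := by
  obtain ⟨l, hl, hs⟩ := List.subperm_of_subset hp.isTrail.edges_nodup (edges_sub hT p q hp)
  have h1 : wt w p = (l.map w).sum := ((hl.map w).sum_eq).symm
  rw [h1]
  refine List.Sublist.sum_le_sum (hs.map w) ?_
  intro x hx
  obtain ⟨e, he, rfl⟩ := List.mem_map.1 hx
  exact hw e (q.edges_subset_edgeSet he)

/-- Three paths of a tree joining three vertices have a common vertex. -/
lemma median (hT : T.IsAcyclic) {a b c : V} (p : T.Walk a b) (q : T.Walk a c) (r : T.Walk b c)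
    (hp : p.IsPath) : ∃ m, m ∈ p.support ∧ m ∈ q.support ∧ m ∈ r.support := by
  by_cases hb : b ∈ q.support
  · exact ⟨b, p.end_mem_support, hb, r.start_mem_support⟩
  obtain ⟨d, hd, h1, h2⟩ := p.exists_boundary_dart {x | x ∈ q.support}
    (by simp) (by simpa using hb)
  refine ⟨d.fst, p.dart_fst_mem_support_of_mem_darts hd, h1, ?_⟩
  have he : d.edge ∈ p.edges := List.mem_map_of_mem hd
  have he2 := edges_sub hT p (q.append r.reverse) hp he
  rw [Walk.edges_append, List.mem_append, Walk.edges_reverse, List.mem_reverse] at he2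
  have hde : d.edge = s(d.fst, d.snd) := rfl
  rw [hde] at he2
  rcases he2 with h | h
  · exact absurd (q.snd_mem_support_of_mem_edges h) h2
  · exact r.fst_mem_support_of_mem_edges h

lemma cross (hT : T.IsAcyclic) (w : Sym2 V → ℝ) (hw : ∀ e ∈ T.edgeSet, 0 ≤ w e)
    {a b c d m : V} (ab : T.Walk a b) (cd : T.Walk c d) (ac : T.Walk a c) (bd : T.Walk b d)
    (hab : ab.IsPath) (hcd : cd.IsPath) (h1 : m ∈ ac.support) (h2 : m ∈ bd.support) :
    wt w ab + wt w cd ≤ wt w ac + wt w bd := by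
  classical
  have e1 := wt_le hT w hw ab ((ac.takeUntil m h1).append (bd.takeUntil m h2).reverse) hab
  have e2 := wt_le hT w hw cd ((ac.dropUntil m h1).reverse.append (bd.dropUntil m h2)) hcd
  rw [wt_append, wt_reverse] at e1 e2
  have e3 : wt w ac = wt w (ac.takeUntil m h1) + wt w (ac.dropUntil m h1) := by
    rw [← wt_append, Walk.take_spec]
  have e4 : wt w bd = wt w (bd.takeUntil m h2) + wt w (bd.dropUntil m h2) := by
    rw [← wt_append, Walk.take_spec]
  linarith

/-- The four-point condition. -/
lemma four_point (hT : T.IsAcyclic) (w : Sym2 V → ℝ) (hw : ∀ e ∈ T.edgeSet, 0 ≤ w e)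
    {a b c d : V} (ab : T.Walk a b) (cd : T.Walk c d) (ac : T.Walk a c) (bd : T.Walk b d)
    (ad : T.Walk a d) (bc : T.Walk b c) (hab : ab.IsPath) (hcd : cd.IsPath) :
    wt w ab + wt w cd ≤ wt w ac + wt w bd ∨ wt w ab + wt w cd ≤ wt w ad + wt w bc := by
  obtain ⟨m, h1, h2, h3⟩ := median hT ab ac bc hab
  have h4 := support_sub hT ab (ad.append bd.reverse) hab h1
  rw [Walk.mem_support_append_iff, Walk.support_reverse, List.mem_reverse] at h4
  rcases h4 with h | h
  · right
    have := cross hT w hw ab cd.reverse ad bc hab hcd.reverse h h3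
    rwa [wt_reverse] at this
  · left
    exact cross hT w hw ab cd ac bd hab hcd h2 h

/-- Endpoints: the four sides of the unit square, each taken twice. -/
def P : Fin 8 → ℝ × ℝ := ![(0,0), (0,0), (0,1), (0,1), (0,0), (0,0), (1,0), (1,0)]

/-- The other endpoints. -/
def Q : Fin 8 → ℝ × ℝ := ![(1,0), (1,0), (1,1), (1,1), (0,1), (0,1), (1,1), (1,1)]

/-- The intersection graph of the doubled sides of a square. -/
def G : SimpleGraph (Fin 8) where
  Adj u v := u ≠ v ∧ (segment ℝ (P u) (Q u) ∩ segment ℝ (P v) (Q v)).Nonempty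
  symm := ⟨fun u v h => ⟨h.1.symm, by rw [Set.inter_comm]; exact h.2⟩⟩
  loopless := ⟨fun _ h => h.1 rfl⟩

lemma G_grid : IsGridIntersectionGraph G := by
  refine ⟨P, Q, ?_, fun u v huv => ⟨fun h => h.2, fun h => ⟨huv, h⟩⟩⟩
  intro v
  fin_cases v <;> simp [P, Q]

lemma adj_of {u v : Fin 8} (h : u ≠ v)
    (h2 : P u = P v ∨ P u = Q v ∨ Q u = P v ∨ Q u = Q v) : G.Adj u v := by
  refine ⟨h, ?_⟩
  rcases h2 with h | h | h | h
  · exact ⟨P u, left_mem_segment _ _ _, h ▸ left_mem_segment _ _ _⟩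
  · exact ⟨P u, left_mem_segment _ _ _, h ▸ right_mem_segment _ _ _⟩
  · exact ⟨Q u, right_mem_segment _ _ _, h ▸ left_mem_segment _ _ _⟩
  · exact ⟨Q u, right_mem_segment _ _ _, h ▸ right_mem_segment _ _ _⟩

lemma adj_cross (u v : Fin 8) (hu : u < 4) (hv : 4 ≤ v) : G.Adj u v := by
  refine adj_of (by omega) ?_
  fin_cases u <;> fin_cases v <;> simp [P, Q] at *

lemma not_adj_h (u v : Fin 8) (hu : u = 0 ∨ u = 1) (hv : v = 2 ∨ v = 3) : ¬ G.Adj u v := by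
  rintro ⟨-, x, ⟨a, b, -, -, hab, h1⟩, ⟨c, d, -, -, hcd, h2⟩⟩
  have h3 := congrArg Prod.snd h1
  have h4 := congrArg Prod.snd h2
  rcases hu with rfl | rfl <;> rcases hv with rfl | rfl <;> simp [P, Q] at h3 h4 <;> linarith

lemma not_adj_v (u v : Fin 8) (hu : u = 4 ∨ u = 5) (hv : v = 6 ∨ v = 7) : ¬ G.Adj u v := by
  rintro ⟨-, x, ⟨a, b, -, -, hab, h1⟩, ⟨c, d, -, -, hcd, h2⟩⟩
  have h3 := congrArg Prod.fst h1
  have h4 := congrArg Prod.fst h2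
  rcases hu with rfl | rfl <;> rcases hv with rfl | rfl <;> simp [P, Q] at h3 h4 <;> linarith

lemma G_not_PCG : ¬ IsPCG G := by
  rintro ⟨n, T, w, f, dmin, dmax, hc, hT, hw, -, -, -, -, hG⟩
  have hex : ∀ x y, ∃ p : T.Walk x y, p.IsPath := fun x y => (hc.preconnected x y).exists_isPath
  choose p hp using hex
  obtain ⟨D, hD⟩ : ∃ D : Fin 8 → Fin 8 → ℝ, ∀ u v, D u v = wt w (p (f u) (f v)) :=
    ⟨_, fun _ _ => rfl⟩
  have hadj : ∀ u v, u ≠ v → (G.Adj u v ↔ dmin ≤ D u v ∧ D u v ≤ dmax) := by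
    intro u v huv
    rw [hG u v huv, hD]
    constructor
    · rintro ⟨q, hq, h⟩
      have := congrArg Subtype.val (hT.path_unique ⟨q, hq⟩ ⟨p (f u) (f v), hp _ _⟩)
      simp only at this
      rw [← this]
      exact h
    · intro h
      exact ⟨_, hp _ _, h⟩
  have fp : ∀ a b c d, D a b + D c d ≤ D a c + D b d ∨ D a b + D c d ≤ D a d + D b c := by
    intro a b c d
    simp only [hD]
    exact four_point hT w hw _ _ _ _ _ _ (hp _ _) (hp _ _)
  -- a long pair in each class is impossible
  have key : ∀ a b c d : Fin 8, a < 4 → b < 4 → 4 ≤ c → 4 ≤ d →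
      dmax < D a b → dmax < D c d → False := by
    intro a b c d ha hb hc hd h1 h2
    have e1 := (hadj a c (by omega)).1 (adj_cross a c ha hc)
    have e2 := (hadj a d (by omega)).1 (adj_cross a d ha hd)
    have e3 := (hadj b c (by omega)).1 (adj_cross b c hb hc)
    have e4 := (hadj b d (by omega)).1 (adj_cross b d hb hd)
    rcases fp a b c d with h | h <;> linarith [e1.2, e2.2, e3.2, e4.2]
  -- not all four nonadjacent pairs of a class are short
  have long : ∀ a b c d : Fin 8, a ≠ b → c ≠ d → a ≠ c → a ≠ d → b ≠ c → b ≠ d →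
      G.Adj a b → G.Adj c d → ¬ G.Adj a c → ¬ G.Adj a d → ¬ G.Adj b c → ¬ G.Adj b d →
      dmax < D a c ∨ dmax < D a d ∨ dmax < D b c ∨ dmax < D b d := by
    intro a b c d h1 h2 h3 h4 h5 h6 g1 g2 g3 g4 g5 g6
    rw [hadj _ _ (by assumption)] at g1 g2 g3 g4 g5 g6
    by_contra! hcon
    obtain ⟨k1, k2, k3, k4⟩ := hcon
    have l3 : D a c < dmin := by by_contra! h; exact g3 ⟨h, k1⟩
    have l4 : D a d < dmin := by by_contra! h; exact g4 ⟨h, k2⟩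
    have l5 : D b c < dmin := by by_contra! h; exact g5 ⟨h, k3⟩
    have l6 : D b d < dmin := by by_contra! h; exact g6 ⟨h, k4⟩
    rcases fp a b c d with h | h <;> linarith [g1.1, g2.1]
  have A := long 0 1 2 3 (by decide) (by decide) (by decide) (by decide) (by decide) (by decide)
    (adj_of (by decide) (by simp [P])) (adj_of (by decide) (by simp [P]))
    (not_adj_h _ _ (by simp) (by simp)) (not_adj_h _ _ (by simp) (by simp))
    (not_adj_h _ _ (by simp) (by simp)) (not_adj_h _ _ (by simp) (by simp))
  have B := long 4 5 6 7 (by decide) (by decide) (by decide) (by decide) (by decide) (by decide)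
    (adj_of (by decide) (by simp [P])) (adj_of (by decide) (by simp [P]))
    (not_adj_v _ _ (by simp) (by simp)) (not_adj_v _ _ (by simp) (by simp))
    (not_adj_v _ _ (by simp) (by simp)) (not_adj_v _ _ (by simp) (by simp))
  rcases A with h | h | h | h <;> rcases B with k | k | k | k <;>
    exact key _ _ _ _ (by decide) (by decide) (by decide) (by decide) h k

end PCGAux

/-- There exists a finite simple graph that is a grid intersection graph but is not a
pairwise compatibility graph. -/
theorem exists_GridIntersectionGraph_not_PCG :
    ∃ (n : ℕ) (G : SimpleGraph (Fin n)), IsGridIntersectionGraph G ∧ ¬ IsPCG G := by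
  exact ⟨8, PCGAux.G, PCGAux.G_grid, PCGAux.G_not_PCG⟩
end

section
/- There exists a finite simple graph that is a circular arc graph but is not a pairwise compatibility graph (PCG). (Theorem 1, part 3.) -/
/-- The closed arc `{(cos θ, sin θ) : a ≤ θ ≤ b}` of the unit circle. -/
def circArc (a b : ℝ) : Set (ℝ × ℝ) :=
  (fun θ : ℝ => (Real.cos θ, Real.sin θ)) '' Set.Icc a b

/-- `G` is a circular arc graph: vertices are represented by closed arcs of the unit
circle, and two distinct vertices are adjacent iff their arcs intersect. -/
def IsCircularArcGraph {V : Type} [Fintype V] (G : SimpleGraph V) : Prop :=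
  ∃ a b : V → ℝ,
    (∀ v, a v ≤ b v) ∧
    ∀ u v : V, u ≠ v →
      (G.Adj u v ↔ (circArc (a u) (b u) ∩ circArc (a v) (b v)).Nonempty)

section TreeMetric

variable {V : Type} {T : SimpleGraph V}

/-- Walking along a path towards a set `S`, stop at the first vertex of `S`. -/
lemma exists_first_hit (S : Set V) {c a : V} (q : T.Walk c a) (hq : q.IsPath) (ha : a ∈ S) :
    ∃ m ∈ S, ∃ r : T.Walk c m, r.IsPath ∧ r.support ⊆ q.support ∧
      ∀ x ∈ r.support, x ∈ S → x = m := by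
  induction q with
  | nil => exact ⟨_, ha, .nil, by simp, by simp, by simp⟩
  | @cons u v w h p ih =>
    by_cases hu : u ∈ S
    · exact ⟨u, hu, .nil, by simp, by simp, by simp⟩
    · rw [SimpleGraph.Walk.cons_isPath_iff] at hq
      obtain ⟨m, hm, r, hr, hsub, hS⟩ := ih hq.1 ha
      refine ⟨m, hm, .cons h r, ?_, ?_, ?_⟩
      · rw [SimpleGraph.Walk.cons_isPath_iff]
        exact ⟨hr, fun hmem => hq.2 (hsub hmem)⟩
      · intro x hx
        simp only [SimpleGraph.Walk.support_cons, List.mem_cons] at hx ⊢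
        exact hx.imp id (fun hx => hsub hx)
      · intro x hx hxS
        simp only [SimpleGraph.Walk.support_cons, List.mem_cons] at hx
        rcases hx with rfl | hx
        · exact absurd hxS hu
        · exact hS x hx hxS

/-- Two paths meeting only at their common endpoint concatenate to a path. -/
lemma isPath_append_of_meet {a b c : V} (p : T.Walk a b) (q : T.Walk b c)
    (hp : p.IsPath) (hq : q.IsPath) (h : ∀ x ∈ p.support, x ∈ q.support → x = b) :
    (p.append q).IsPath := by
  rw [SimpleGraph.Walk.isPath_def, SimpleGraph.Walk.support_append, List.nodup_append']
  rw [SimpleGraph.Walk.isPath_def] at hp hq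
  have hq' := hq
  rw [SimpleGraph.Walk.support_eq_cons, List.nodup_cons] at hq'
  refine ⟨hp, hq'.2, ?_⟩
  intro x hx hx'
  have := h x hx (List.mem_of_mem_tail hx')
  subst this
  exact hq'.1 hx'

/-- `D` is the function measuring the total weight of tree paths. -/
def IsPathDist (T : SimpleGraph V) (w : Sym2 V → ℝ) (D : V → V → ℝ) : Prop :=
  ∀ (x y : V) (p : T.Walk x y), p.IsPath → (p.edges.map w).sum = D x y

variable {w : Sym2 V → ℝ} {D : V → V → ℝ}

lemma exists_pathDist (hc : T.Connected) (ha : T.IsAcyclic) (w : Sym2 V → ℝ) :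
    ∃ D, IsPathDist T w D := by
  choose P hP using hc.exists_isPath
  refine ⟨fun x y => ((P x y).edges.map w).sum, fun x y p hp => ?_⟩
  have := ha.path_unique ⟨p, hp⟩ ⟨P x y, hP x y⟩
  have h2 : p = P x y := congrArg Subtype.val this
  rw [h2]

lemma IsPathDist.symm (hD : IsPathDist T w D) (hc : T.Connected) (x y : V) :
    D x y = D y x := by
  obtain ⟨p, hp⟩ := hc.exists_isPath x y
  rw [← hD x y p hp, ← hD y x p.reverse hp.reverse, SimpleGraph.Walk.edges_reverse,
    List.map_reverse, List.sum_reverse]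

lemma IsPathDist.nonneg (hD : IsPathDist T w D) (hc : T.Connected)
    (hw : ∀ e ∈ T.edgeSet, 0 ≤ w e) (x y : V) : 0 ≤ D x y := by
  obtain ⟨p, hp⟩ := hc.exists_isPath x y
  rw [← hD x y p hp]
  apply List.sum_nonneg
  intro z hz
  obtain ⟨e, he, rfl⟩ := List.mem_map.1 hz
  exact hw e (p.edges_subset_edgeSet he)

lemma IsPathDist.add (hD : IsPathDist T w D) {a b m : V} (p : T.Walk a b) (hp : p.IsPath)
    (hm : m ∈ p.support) : D a b = D a m + D m b := by
  classical
  rw [← hD a b p hp, ← hD a m _ (hp.takeUntil hm), ← hD m b _ (hp.dropUntil hm),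
    ← List.sum_append, ← List.map_append, ← SimpleGraph.Walk.edges_append,
    SimpleGraph.Walk.take_spec]

/-- Every vertex has a gate on every path. -/
lemma IsPathDist.gate (hD : IsPathDist T w D) (hc : T.Connected) {a b : V} (p : T.Walk a b)
    (hp : p.IsPath) (c : V) :
    ∃ m ∈ p.support, D c a = D c m + D m a ∧ D c b = D c m + D m b := by
  classical
  obtain ⟨q, hq⟩ := hc.exists_isPath c a
  obtain ⟨m, hm, r, hr, -, hS⟩ := exists_first_hit {x | x ∈ p.support} q hq
    (p.start_mem_support)
  refine ⟨m, hm, ?_, ?_⟩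
  · have h := isPath_append_of_meet r (p.takeUntil m hm).reverse hr (hp.takeUntil hm).reverse
      (fun x hx hx' => hS x hx (by
        rw [SimpleGraph.Walk.support_reverse, List.mem_reverse] at hx'
        exact p.support_takeUntil_subset_support hm hx'))
    exact hD.add _ h (by simp)
  · have h := isPath_append_of_meet r (p.dropUntil m hm) hr (hp.dropUntil hm)
      (fun x hx hx' => hS x hx (p.support_dropUntil_subset_support hm hx'))
    exact hD.add _ h (by simp)

lemma IsPathDist.triangle (hD : IsPathDist T w D) (hc : T.Connected)
    (hw : ∀ e ∈ T.edgeSet, 0 ≤ w e) (x y z : V) : D x z ≤ D x y + D y z := by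
  obtain ⟨p, hp⟩ := hc.exists_isPath x z
  obtain ⟨m, hm, h1, h2⟩ := hD.gate hc p hp y
  have h3 := hD.add p hp hm
  have h4 := hD.nonneg hc hw y m
  rw [hD.symm hc x y, h1, h2, h3, hD.symm hc x m]
  linarith

/-- The four-point condition. -/
lemma IsPathDist.four_point (hD : IsPathDist T w D) (hc : T.Connected)
    (hw : ∀ e ∈ T.edgeSet, 0 ≤ w e) (a b c d : V) :
    D a b + D c d ≤ D a c + D b d ∨ D a b + D c d ≤ D a d + D b c := by
  classical
  obtain ⟨p, hp⟩ := hc.exists_isPath a b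
  obtain ⟨m, hm, hm1, hm2⟩ := hD.gate hc p hp c
  obtain ⟨y, hy, hy1, hy2⟩ := hD.gate hc p hp d
  have e1 := hD.triangle hc hw c m d
  have e2 := hD.triangle hc hw m y d
  have am := hD.add p hp hm
  have ay := hD.add p hp hy
  have s1 := hD.symm hc a c
  have s2 := hD.symm hc b d
  have s3 := hD.symm hc a d
  have s4 := hD.symm hc b c
  have s5 := hD.symm hc a m
  have s6 := hD.symm hc a y
  have s7 := hD.symm hc m y
  have s8 := hD.symm hc d y
  have hy' := hy
  rw [← p.take_spec hm, SimpleGraph.Walk.mem_support_append_iff] at hy'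
  rcases hy' with h | h
  · left
    have := hD.add _ (hp.takeUntil hm) h
    linarith
  · right
    have := hD.add _ (hp.dropUntil hm) h
    linarith

end TreeMetric

/-- Opposite quarter arcs: right/left (`0`, `1`) and top/bottom (`2`, `3`). -/
def oppQ (i j : Fin 4) : Prop := i ≠ j ∧ i.val / 2 = j.val / 2

instance (i j : Fin 4) : Decidable (oppQ i j) := by unfold oppQ; infer_instance

/-- The quarter of each of the eight vertices; every quarter is used twice. -/
def qrt (u : Fin 8) : Fin 4 := ⟨2 * (u.val / 4) + u.val % 2, by omega⟩

/-- The join of two copies of `2 K₂`. -/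
def joinGraph : SimpleGraph (Fin 8) where
  Adj u v := u ≠ v ∧ ¬ oppQ (qrt u) (qrt v)
  symm := ⟨fun u v h => ⟨h.1.symm, fun h' => h.2 ⟨h'.1.symm, h'.2.symm⟩⟩⟩
  loopless := ⟨fun _ h => h.1 rfl⟩

/-- Centre of each quarter arc. -/
noncomputable def ctr : Fin 4 → ℝ := ![0, Real.pi, Real.pi / 2, -(Real.pi / 2)]

lemma cos_near_zero {t : ℝ} (h1 : -(Real.pi / 4) ≤ t) (h2 : t ≤ Real.pi / 4) : 0 < Real.cos t :=
  Real.cos_pos_of_mem_Ioo ⟨by linarith [Real.pi_pos], by linarith [Real.pi_pos]⟩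

/-- Quarter `i` as an arc. -/
noncomputable def qArc (i : Fin 4) : Set (ℝ × ℝ) :=
  circArc (ctr i - Real.pi / 4) (ctr i + Real.pi / 4)

lemma mem_qArc {i : Fin 4} {x : ℝ × ℝ} (h : x ∈ qArc i) :
    ∃ t, 0 < Real.cos t ∧ x = (Real.cos (ctr i + t), Real.sin (ctr i + t)) := by
  obtain ⟨s, ⟨hs1, hs2⟩, rfl⟩ := h
  refine ⟨s - ctr i, cos_near_zero (by linarith) (by linarith), ?_⟩
  simp

lemma left_mem_qArc (i : Fin 4) :
    (Real.cos (ctr i - Real.pi / 4), Real.sin (ctr i - Real.pi / 4)) ∈ qArc i :=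
  ⟨_, ⟨le_refl _, by linarith [Real.pi_pos]⟩, rfl⟩

lemma right_mem_qArc (i : Fin 4) :
    (Real.cos (ctr i + Real.pi / 4), Real.sin (ctr i + Real.pi / 4)) ∈ qArc i :=
  ⟨_, ⟨by linarith [Real.pi_pos], le_refl _⟩, rfl⟩

lemma qArc_consecutive {i j : Fin 4} (h : ctr j = ctr i + Real.pi / 2 ∨
    ctr j + 2 * Real.pi = ctr i + Real.pi / 2) : (qArc i ∩ qArc j).Nonempty := by
  refine ⟨_, right_mem_qArc i, ?_⟩
  have := left_mem_qArc j
  rcases h with h | h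
  · have e : ctr j - Real.pi / 4 = ctr i + Real.pi / 4 := by linarith
    rwa [e] at this
  · have e : ctr j - Real.pi / 4 = ctr i + Real.pi / 4 - 2 * Real.pi := by linarith
    rwa [e, Real.cos_sub_two_pi, Real.sin_sub_two_pi] at this

lemma qArc_disjoint_01 : ¬ (qArc 0 ∩ qArc 1).Nonempty := by
  rintro ⟨x, h0, h1⟩
  obtain ⟨s, hs, rfl⟩ := mem_qArc h0
  obtain ⟨t, ht, h⟩ := mem_qArc h1
  have h := congrArg Prod.fst h
  simp [ctr, Real.cos_add] at h
  linarith

lemma qArc_disjoint_23 : ¬ (qArc 2 ∩ qArc 3).Nonempty := by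
  rintro ⟨x, h0, h1⟩
  obtain ⟨s, hs, rfl⟩ := mem_qArc h0
  obtain ⟨t, ht, h⟩ := mem_qArc h1
  have h := congrArg Prod.snd h
  simp [ctr, Real.sin_add] at h
  linarith

lemma qArc_inter_iff (i j : Fin 4) : (qArc i ∩ qArc j).Nonempty ↔ ¬ oppQ i j := by
  have h02 : (qArc 0 ∩ qArc 2).Nonempty := qArc_consecutive (by left; simp [ctr])
  have h21 : (qArc 2 ∩ qArc 1).Nonempty := qArc_consecutive (by left; simp [ctr])
  have h13 : (qArc 1 ∩ qArc 3).Nonempty := qArc_consecutive (by right; simp [ctr]; ring)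
  have h30 : (qArc 3 ∩ qArc 0).Nonempty := qArc_consecutive (by left; simp [ctr])
  have hd : ∀ k, (qArc k ∩ qArc k).Nonempty := fun k =>
    ⟨_, left_mem_qArc k, left_mem_qArc k⟩
  have n01 := qArc_disjoint_01
  have n23 := qArc_disjoint_23
  have hcomm : ∀ k l, (qArc k ∩ qArc l).Nonempty ↔ (qArc l ∩ qArc k).Nonempty := fun k l => by
    rw [Set.inter_comm]
  by_cases ho : oppQ i j
  · refine ⟨fun h => ?_, fun h => absurd ho h⟩
    exfalso
    have key : (i = 0 ∧ j = 1) ∨ (i = 1 ∧ j = 0) ∨ (i = 2 ∧ j = 3) ∨ (i = 3 ∧ j = 2) := by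
      clear h
      revert i j
      decide
    rcases key with ⟨rfl, rfl⟩ | ⟨rfl, rfl⟩ | ⟨rfl, rfl⟩ | ⟨rfl, rfl⟩
    · exact n01 h
    · exact n01 ((hcomm _ _).1 h)
    · exact n23 h
    · exact n23 ((hcomm _ _).1 h)
  · refine ⟨fun _ => ho, fun _ => ?_⟩
    have key : i = j ∨ (i = 0 ∧ j = 2) ∨ (i = 2 ∧ j = 0) ∨ (i = 2 ∧ j = 1) ∨ (i = 1 ∧ j = 2) ∨
        (i = 1 ∧ j = 3) ∨ (i = 3 ∧ j = 1) ∨ (i = 3 ∧ j = 0) ∨ (i = 0 ∧ j = 3) := by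
      revert i j
      decide
    rcases key with rfl | ⟨rfl, rfl⟩ | ⟨rfl, rfl⟩ | ⟨rfl, rfl⟩ | ⟨rfl, rfl⟩ | ⟨rfl, rfl⟩ |
      ⟨rfl, rfl⟩ | ⟨rfl, rfl⟩ | ⟨rfl, rfl⟩
    · exact hd _
    all_goals first | assumption | exact (hcomm _ _).1 (by assumption)

lemma joinGraph_circular : IsCircularArcGraph joinGraph := by
  refine ⟨fun u => ctr (qrt u) - Real.pi / 4, fun u => ctr (qrt u) + Real.pi / 4,
    fun u => by dsimp only; linarith [Real.pi_pos], fun u v huv => ?_⟩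
  have h := qArc_inter_iff (qrt u) (qrt v)
  unfold qArc at h
  rw [h]
  exact ⟨fun h => h.2, fun h => ⟨huv, h⟩⟩

/-- A four-cycle of non-edges `a b c d` all of whose values are at most `M` violates the
four-point condition (all four values then lie below `m`). -/
lemma exists_long {X : Type} (D : X → X → ℝ) (m M : ℝ) (a b c d : X)
    (fp : D a c + D b d ≤ D a b + D c d ∨ D a c + D b d ≤ D a d + D c b)
    (ac : m ≤ D a c) (bd : m ≤ D b d)
    (ab : ¬ (m ≤ D a b ∧ D a b ≤ M)) (cd : ¬ (m ≤ D c d ∧ D c d ≤ M))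
    (ad : ¬ (m ≤ D a d ∧ D a d ≤ M)) (cb : ¬ (m ≤ D c b ∧ D c b ≤ M)) :
    M < D a b ∨ M < D c d ∨ M < D a d ∨ M < D c b := by
  by_contra! hcon
  obtain ⟨h1, h2, h3, h4⟩ := hcon
  have h1' : D a b < m := not_le.1 fun h => ab ⟨h, h1⟩
  have h2' : D c d < m := not_le.1 fun h => cd ⟨h, h2⟩
  have h3' : D a d < m := not_le.1 fun h => ad ⟨h, h3⟩
  have h4' : D c b < m := not_le.1 fun h => cb ⟨h, h4⟩
  rcases fp with h | h <;> linarith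

lemma joinGraph_not_PCG : ¬ IsPCG joinGraph := by
  rintro ⟨n, T, w, f, m, M, hc, ha, hw, -, -, -, -, hadj⟩
  obtain ⟨D, hD⟩ := exists_pathDist hc ha w
  have hadj' : ∀ u v : Fin 8, u ≠ v →
      (joinGraph.Adj u v ↔ m ≤ D (f u) (f v) ∧ D (f u) (f v) ≤ M) := by
    intro u v huv
    rw [hadj u v huv]
    constructor
    · rintro ⟨p, hp, h1, h2⟩
      rw [hD _ _ p hp] at h1 h2
      exact ⟨h1, h2⟩
    · rintro ⟨h1, h2⟩
      obtain ⟨p, hp⟩ := hc.exists_isPath (f u) (f v)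
      exact ⟨p, hp, by rwa [hD _ _ p hp], by rwa [hD _ _ p hp]⟩
  have hE : ∀ u v : Fin 8, (u ≠ v ∧ ¬ oppQ (qrt u) (qrt v)) →
      m ≤ D (f u) (f v) ∧ D (f u) (f v) ≤ M := fun u v h => (hadj' u v h.1).1 h
  have hN : ∀ u v : Fin 8, (u ≠ v ∧ oppQ (qrt u) (qrt v)) →
      ¬ (m ≤ D (f u) (f v) ∧ D (f u) (f v) ≤ M) := fun u v h h' =>
    ((hadj' u v h.1).2 h').2 h.2
  have fp := fun a b c d => hD.four_point hc hw (f a) (f b) (f c) (f d)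
  -- each of the two four-cycles of non-edges contains a long pair
  have hA : ∃ a b : Fin 8, a.val < 4 ∧ b.val < 4 ∧ M < D (f a) (f b) := by
    have h := exists_long D m M (f 0) (f 1) (f 2) (f 3)
      (fp 0 2 1 3)
      (hE 0 2 (by decide)).1 (hE 1 3 (by decide)).1 (hN 0 1 (by decide)) (hN 2 3 (by decide))
      (hN 0 3 (by decide)) (hN 2 1 (by decide))
    rcases h with h | h | h | h
    exacts [⟨0, 1, by decide, by decide, h⟩, ⟨2, 3, by decide, by decide, h⟩,
      ⟨0, 3, by decide, by decide, h⟩, ⟨2, 1, by decide, by decide, h⟩]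
  have hB : ∃ a b : Fin 8, 4 ≤ a.val ∧ 4 ≤ b.val ∧ M < D (f a) (f b) := by
    have h := exists_long D m M (f 4) (f 5) (f 6) (f 7) (fp 4 6 5 7)
      (hE 4 6 (by decide)).1 (hE 5 7 (by decide)).1 (hN 4 5 (by decide)) (hN 6 7 (by decide))
      (hN 4 7 (by decide)) (hN 6 5 (by decide))
    rcases h with h | h | h | h
    exacts [⟨4, 5, by decide, by decide, h⟩, ⟨6, 7, by decide, by decide, h⟩,
      ⟨4, 7, by decide, by decide, h⟩, ⟨6, 5, by decide, by decide, h⟩]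
  obtain ⟨a, b, ha4, hb4, hab⟩ := hA
  obtain ⟨c, d, hc4, hd4, hcd⟩ := hB
  have cross : ∀ u v : Fin 8, u.val < 4 → 4 ≤ v.val → D (f u) (f v) ≤ M := fun u v hu hv =>
    (hE u v (by revert u v; decide)).2
  have h1 := cross a c ha4 hc4
  have h2 := cross b d hb4 hd4
  have h3 := cross a d ha4 hd4
  have h4 := cross b c hb4 hc4
  rcases fp a b c d with h | h <;> linarith

/-- There exists a finite simple graph that is a circular arc graph but is not a
pairwise compatibility graph. -/
theorem exists_CircularArcGraph_not_PCG :
    ∃ (n : ℕ) (G : SimpleGraph (Fin n)), IsCircularArcGraph G ∧ ¬ IsPCG G := by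
  exact ⟨8, joinGraph, joinGraph_circular, joinGraph_not_PCG⟩
end

section
/- There exists a finite simple graph that is a square intersection graph but is not a pairwise compatibility graph (PCG). (Corollary 1, square case.) -/
/-- `G` is a square intersection graph: vertices are represented by axis-parallel closed
squares `[x, x+s] × [y, y+s]` with `s > 0` in the plane, and two distinct vertices are
adjacent iff their squares intersect. -/
def IsSquareIntersectionGraph {V : Type} [Fintype V] (G : SimpleGraph V) : Prop :=
  ∃ x y s : V → ℝ,
    (∀ v, 0 < s v) ∧
    ∀ u v : V, u ≠ v →
      (G.Adj u v ↔
        ((Set.Icc (x u) (x u + s u) ×ˢ Set.Icc (y u) (y u + s u)) ∩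
          (Set.Icc (x v) (x v + s v) ×ˢ Set.Icc (y v) (y v + s v))).Nonempty)

open SimpleGraph

/-- Every walk from `x` to `y` visits `m`. -/
def WSep {n : ℕ} (T : SimpleGraph (Fin n)) (x m y : Fin n) : Prop :=
  ∀ p : T.Walk x y, m ∈ p.support

theorem WSep.symm {n : ℕ} {T : SimpleGraph (Fin n)} {x m y : Fin n} (h : WSep T x m y) :
    WSep T y m x := fun p => by
  have := h p.reverse
  simpa using this

theorem WSep.or {n : ℕ} {T : SimpleGraph (Fin n)} {x m y : Fin n} (h : WSep T x m y) (d : Fin n) :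
    WSep T x m d ∨ WSep T d m y := by
  by_contra hc
  rw [not_or] at hc
  obtain ⟨h1, h2⟩ := hc
  unfold WSep at h1 h2
  push Not at h1 h2
  obtain ⟨p, hp⟩ := h1
  obtain ⟨q, hq⟩ := h2
  have := h (p.append q)
  rw [Walk.mem_support_append_iff] at this
  tauto

theorem sep_of_path {n : ℕ} {T : SimpleGraph (Fin n)} (hT : T.IsAcyclic) {x m y : Fin n}
    (p : T.Walk x y) (hp : p.IsPath) (hm : m ∈ p.support) : WSep T x m y := fun q => by
  have h := hT.path_unique ⟨p, hp⟩ ⟨q.bypass, q.bypass_isPath⟩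
  have h' : p = q.bypass := congrArg Subtype.val h
  exact q.support_bypass_subset_support (h' ▸ hm)

theorem exists_median_s3 {n : ℕ} {T : SimpleGraph (Fin n)} (hT : T.IsAcyclic) (c : Fin n)
    {a b : Fin n} (p : T.Walk a b) (hp : p.IsPath) :
    ∃ m, WSep T a m b ∧ WSep T a m c ∧ WSep T b m c := by
  induction p with
  | nil => exact ⟨_, fun q => q.start_mem_support, fun q => q.start_mem_support,
      fun q => q.start_mem_support⟩
  | @cons a a' b h p ih =>
    have hp' := hp
    rw [Walk.cons_isPath_iff] at hp'
    obtain ⟨m, h1, h2, h3⟩ := ih hp'.1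
    by_cases hm : WSep T a m c
    · refine ⟨m, sep_of_path hT _ hp ?_, hm, h3⟩
      rw [Walk.support_cons]
      exact List.mem_cons_of_mem _ (h1 p)
    · unfold WSep at hm
      push Not at hm
      obtain ⟨q, hq⟩ := hm
      have hma : m = a' := by
        have := h2 (Walk.cons h.symm q)
        rw [Walk.support_cons, List.mem_cons] at this
        tauto
      subst hma
      have hs : WSep T m a c := by
        apply sep_of_path hT (Walk.cons h.symm q.bypass)
        · rw [Walk.cons_isPath_iff]
          exact ⟨q.bypass_isPath, fun hh => hq (q.support_bypass_subset_support hh)⟩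
        · simp
      refine ⟨a, fun q => q.start_mem_support, fun q => q.start_mem_support, fun r => ?_⟩
      exact r.support_dropUntil_subset_support (h3 r) (hs _)

theorem four_point {n : ℕ} {T : SimpleGraph (Fin n)} (hc : T.Connected) (hT : T.IsAcyclic)
    (w : Sym2 (Fin n) → ℝ) (hw : ∀ e ∈ T.edgeSet, 0 ≤ w e) :
    ∃ D : Fin n → Fin n → ℝ,
      (∀ u v, ∀ p : T.Walk u v, p.IsPath → (p.edges.map w).sum = D u v) ∧
      ∀ a b c d, D a b + D c d ≤ D a c + D b d ∨ D a b + D c d ≤ D a d + D b c := by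
  have hex : ∀ u v, ∃ p : T.Walk u v, p.IsPath := fun u v => by
    obtain ⟨p⟩ := hc.preconnected u v
    exact ⟨p.bypass, p.bypass_isPath⟩
  choose P hP using hex
  have hD : ∀ u v, ∀ p : T.Walk u v, p.IsPath →
      (p.edges.map w).sum = ((P u v).edges.map w).sum := fun u v p hp => by
    have h := hT.path_unique ⟨p, hp⟩ ⟨P u v, hP u v⟩
    have h' : p = P u v := congrArg Subtype.val h
    rw [h']
  refine ⟨fun u v => ((P u v).edges.map w).sum, hD, ?_⟩
  obtain ⟨D, hDdef⟩ : ∃ D : Fin n → Fin n → ℝ, ∀ u v, D u v = ((P u v).edges.map w).sum :=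
    ⟨_, fun _ _ => rfl⟩
  simp only [← hDdef] at hD ⊢
  have hsymm : ∀ u v, D u v = D v u := fun u v => by
    rw [← hD v u _ (hP u v).reverse, hDdef]
    simp [List.sum_reverse]
  have htri : ∀ u v x, D u v ≤ D u x + D x v := fun u v x => by
    rw [hDdef u x, hDdef x v, ← List.sum_append, ← List.map_append, ← Walk.edges_append,
      ← hD u v _ ((P u x).append (P x v)).bypass_isPath]
    apply List.Sublist.sum_le_sum
    · exact (Walk.edges_bypass_sublist_edges _).map w
    · intro r hr
      obtain ⟨e, he, rfl⟩ := List.mem_map.1 hr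
      exact hw e (Walk.edges_subset_edgeSet _ he)
  have hsep : ∀ u m v, WSep T u m v → D u v = D u m + D m v := fun u m v h => by
    have hm := h (P u v)
    rw [← hD u m _ ((hP u v).takeUntil hm), ← hD m v _ ((hP u v).dropUntil hm),
      ← List.sum_append, ← List.map_append, ← Walk.edges_append, Walk.take_spec, hDdef]
  intro a b c d
  obtain ⟨m, h1, h2, h3⟩ := exists_median_s3 hT c (P a b) (hP a b)
  have e1 := hsep _ _ _ h1
  have e2 := hsep _ _ _ h2
  have e3 := hsep _ _ _ h3
  have ta := htri a d m
  have tb := htri b d m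
  have tc := htri c d m
  have s1 := hsymm m b
  have s2 := hsymm m c
  have key : ∀ x y, WSep T x m y → D x d = D x m + D m d ∨ D y d = D y m + D m d := by
    intro x y h
    rcases h.or d with h | h
    · exact Or.inl (hsep _ _ _ h)
    · exact Or.inr (hsep _ _ _ h.symm)
  rcases key _ _ h1 with k1 | k1
  · right; linarith
  · left; linarith

/-- The graph: a 4-cycle with each vertex doubled. -/
def G8 : SimpleGraph (Fin 8) where
  Adj u v := u ≠ v ∧ (v.val / 2 + 2) % 4 ≠ u.val / 2
  symm := ⟨by decide⟩
  loopless := ⟨by decide⟩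

theorem G8_square : IsSquareIntersectionGraph G8 := by
  refine ⟨![0, 0, 3, 3, 0, 0, -3, -3], ![3, 3, 0, 0, -3, -3, 0, 0], fun _ => 4,
    fun _ => by norm_num, fun u v huv => ?_⟩
  rw [Set.prod_inter_prod, Set.prod_nonempty_iff, Set.Icc_inter_Icc, Set.Icc_inter_Icc,
    Set.nonempty_Icc, Set.nonempty_Icc]
  simp only [sup_le_iff, le_inf_iff]
  revert huv
  fin_cases u <;> fin_cases v <;> norm_num [G8]

theorem G8_not_PCG : ¬ IsPCG G8 := by
  rintro ⟨n, T, w, f, dmin, dmax, hc, hT, hw, -, -, -, -, hadj⟩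
  obtain ⟨D, hD, h4⟩ := four_point hc hT w hw
  have hiff : ∀ u v : Fin 8, u ≠ v →
      (G8.Adj u v ↔ dmin ≤ D (f u) (f v) ∧ D (f u) (f v) ≤ dmax) := by
    intro u v huv
    rw [hadj u v huv]
    constructor
    · rintro ⟨p, hp, h⟩
      rwa [hD _ _ p hp] at h
    · intro h
      obtain ⟨p⟩ := hc.preconnected (f u) (f v)
      exact ⟨p.bypass, p.bypass_isPath, by rwa [hD _ _ _ p.bypass_isPath]⟩
  have hyes : ∀ u v : Fin 8, u ≠ v ∧ (v.val / 2 + 2) % 4 ≠ u.val / 2 →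
      dmin ≤ D (f u) (f v) ∧ D (f u) (f v) ≤ dmax := fun u v h => (hiff u v h.1).1 h
  have hno : ∀ u v : Fin 8, u ≠ v → (v.val / 2 + 2) % 4 = u.val / 2 →
      D (f u) (f v) < dmin ∨ dmax < D (f u) (f v) := fun u v h1 h2 => by
    by_contra hh
    push Not at hh
    exact ((hiff u v h1).2 hh).2 h2
  -- some non-edge inside each doubled opposite pair is long
  have long : ∀ a b c d : Fin 8, (a ≠ b ∧ (b.val / 2 + 2) % 4 ≠ a.val / 2) →
      (c ≠ d ∧ (d.val / 2 + 2) % 4 ≠ c.val / 2) →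
      D (f a) (f c) < dmin ∨ dmax < D (f a) (f c) → D (f b) (f d) < dmin ∨ dmax < D (f b) (f d) →
      D (f a) (f d) < dmin ∨ dmax < D (f a) (f d) → D (f b) (f c) < dmin ∨ dmax < D (f b) (f c) →
      ∃ x y, (x = a ∨ x = b) ∧ (y = c ∨ y = d) ∧ dmax < D (f x) (f y) := by
    intro a b c d hab hcd h1 h2 h3 h4'
    by_contra hh
    push Not at hh
    have g1 := h1.resolve_right (not_lt.2 (hh a c (Or.inl rfl) (Or.inl rfl)))
    have g2 := h2.resolve_right (not_lt.2 (hh b d (Or.inr rfl) (Or.inr rfl)))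
    have g3 := h3.resolve_right (not_lt.2 (hh a d (Or.inl rfl) (Or.inr rfl)))
    have g4 := h4'.resolve_right (not_lt.2 (hh b c (Or.inr rfl) (Or.inl rfl)))
    have y1 := hyes _ _ hab
    have y2 := hyes _ _ hcd
    rcases h4 (f a) (f b) (f c) (f d) with h | h <;> linarith [y1.1, y2.1]
  obtain ⟨x, y, hx, hy, hxy⟩ := long 0 1 4 5 (by decide) (by decide)
    (hno _ _ (by decide) (by decide)) (hno _ _ (by decide) (by decide))
    (hno _ _ (by decide) (by decide)) (hno _ _ (by decide) (by decide))
  obtain ⟨z, t, hz, ht, hzt⟩ := long 2 3 6 7 (by decide) (by decide)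
    (hno _ _ (by decide) (by decide)) (hno _ _ (by decide) (by decide))
    (hno _ _ (by decide) (by decide)) (hno _ _ (by decide) (by decide))
  have c1 := (hyes x z (by clear * - hx hz; rcases hx with rfl | rfl <;> rcases hz with rfl | rfl <;> decide)).2
  have c2 := (hyes y t (by clear * - hy ht; rcases hy with rfl | rfl <;> rcases ht with rfl | rfl <;> decide)).2
  have c3 := (hyes x t (by clear * - hx ht; rcases hx with rfl | rfl <;> rcases ht with rfl | rfl <;> decide)).2
  have c4 := (hyes y z (by clear * - hy hz; rcases hy with rfl | rfl <;> rcases hz with rfl | rfl <;> decide)).2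
  rcases h4 (f x) (f y) (f z) (f t) with h | h <;> linarith

/-- There exists a finite simple graph that is a square intersection graph but is not a
pairwise compatibility graph. -/
theorem exists_SquareIntersectionGraph_not_PCG :
    ∃ (n : ℕ) (G : SimpleGraph (Fin n)), IsSquareIntersectionGraph G ∧ ¬ IsPCG G :=
  ⟨8, G8, G8_square, G8_not_PCG⟩
end

section
/- There exists a finite simple graph that is a permutation graph but is not a pairwise compatibility graph (PCG). (Corollary 2, permutation case.) -/
/-- `G` is a permutation graph: vertices are represented by closed segments from
`(a,0)` to `(b,1)` between the lines `y = 0` and `y = 1`, and two distinct vertices are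
adjacent iff their segments intersect. -/
def IsPermutationGraph {V : Type} [Fintype V] (G : SimpleGraph V) : Prop :=
  ∃ a b : V → ℝ,
    ∀ u v : V, u ≠ v →
      (G.Adj u v ↔
        (segment ℝ ((a u, 0) : ℝ × ℝ) ((b u, 1) : ℝ × ℝ) ∩
          segment ℝ ((a v, 0) : ℝ × ℝ) ((b v, 1) : ℝ × ℝ)).Nonempty)

open SimpleGraph in
/-- From any walk ending in a set `S`, extract a path reaching `S` only at its end. -/
theorem exists_path_first_hit {n : ℕ} {T : SimpleGraph (Fin n)} (S : Set (Fin n))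
    {c x : Fin n} (W : T.Walk c x) (hx : x ∈ S) :
    ∃ (z : Fin n) (Q : T.Walk c z), z ∈ S ∧ Q.IsPath ∧ ∀ y ∈ Q.support, y ∈ S → y = z := by
  induction W with
  | nil => exact ⟨_, Walk.nil, hx, Walk.IsPath.nil, by simp⟩
  | @cons u v w h p ih =>
    by_cases hu : u ∈ S
    · exact ⟨u, Walk.nil, hu, Walk.IsPath.nil, by simp⟩
    · obtain ⟨z, Q, hz, hQ, hQS⟩ := ih hx
      by_cases hm : u ∈ Q.support
      · refine ⟨z, Q.dropUntil u hm, hz, hQ.dropUntil hm, ?_⟩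
        intro y hy hyS
        exact hQS y (Q.support_dropUntil_subset_support hm hy) hyS
      · refine ⟨z, Walk.cons h Q, hz, hQ.cons hm, ?_⟩
        intro y hy hyS
        rw [Walk.support_cons, List.mem_cons] at hy
        rcases hy with rfl | hy
        · exact absurd hyS hu
        · exact hQS y hy hyS

open SimpleGraph in
theorem isPath_append_of_disjoint {n : ℕ} {T : SimpleGraph (Fin n)} {a b c : Fin n}
    (p : T.Walk a b) (q : T.Walk b c) (hp : p.IsPath) (hq : q.IsPath)
    (h : ∀ y ∈ p.support, y ∈ q.support → y = b) : (p.append q).IsPath := by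
  induction p with
  | nil => simpa using hq
  | @cons u v w e p ih =>
    rw [Walk.cons_append]
    rw [Walk.cons_isPath_iff] at hp
    refine (ih q hp.1 hq (fun y hy hy' => h y (by simp [hy]) hy')).cons ?_
    intro hm
    rw [Walk.mem_support_append_iff] at hm
    rcases hm with hm | hm
    · exact hp.2 hm
    · have := h u (by simp) hm
      subst this
      exact hp.2 (Walk.end_mem_support p)

open SimpleGraph in
/-- The four-point condition for weighted trees. -/
theorem exists_tree_metric {n : ℕ} (T : SimpleGraph (Fin n)) (w : Sym2 (Fin n) → ℝ)
    (hc : T.Connected) (ha : T.IsAcyclic) (hw : ∀ e ∈ T.edgeSet, 0 ≤ w e) :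
    ∃ D : Fin n → Fin n → ℝ,
      (∀ (x y : Fin n) (p : T.Walk x y), p.IsPath → (p.edges.map w).sum = D x y) ∧
      (∀ x y, D x y = D y x) ∧
      (∀ a b c d, D a b + D c d ≤ D a c + D b d ∨ D a b + D c d ≤ D a d + D b c) := by
  have hex : ∀ x y, ∃ p : T.Walk x y, p.IsPath := fun x y => by
    obtain ⟨p⟩ := hc.preconnected x y
    exact ⟨p.bypass, p.bypass_isPath⟩
  choose P hP using hex
  let D : Fin n → Fin n → ℝ := fun x y => ((P x y).edges.map w).sum
  have hD : ∀ (x y : Fin n) (p : T.Walk x y), p.IsPath → (p.edges.map w).sum = D x y := by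
    intro x y p hp
    have : p = P x y := congrArg Subtype.val (ha.path_unique ⟨p, hp⟩ ⟨P x y, hP x y⟩)
    rw [this]
  have hsym : ∀ x y, D x y = D y x := by
    intro x y
    rw [← hD y x (P x y).reverse (hP x y).reverse, Walk.edges_reverse, List.map_reverse,
      List.sum_reverse]
  have happ : ∀ (x y z : Fin n) (p : T.Walk x y) (q : T.Walk y z), (p.append q).IsPath →
      D x z = D x y + D y z := by
    intro x y z p q h
    rw [← hD _ _ _ h, ← hD _ _ p h.of_append_left, ← hD _ _ q h.of_append_right,
      Walk.edges_append, List.map_append, List.sum_append]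
  have hsplit : ∀ (x y z : Fin n) (p : T.Walk x y), p.IsPath → z ∈ p.support →
      D x y = D x z + D z y := by
    intro x y z p hp hz
    refine happ x z y (p.takeUntil z hz) (p.dropUntil z hz) ?_
    rw [Walk.take_spec]; exact hp
  have hcons : ∀ (u v : Fin n), T.Adj u v → ∀ y, D u y ≤ w s(u, v) + D v y := by
    intro u v huv y
    have h0 : 0 ≤ w s(u, v) := hw _ huv
    by_cases hm : u ∈ (P v y).support
    · have h1 := hsplit v y u _ (hP v y) hm
      have h2 := hD v u (Walk.cons huv.symm Walk.nil) (by simp [huv.ne'])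
      simp [Sym2.eq_swap] at h2
      have h3 : w s(u, v) = w s(v, u) := by rw [Sym2.eq_swap]
      linarith
    · have h1 := hD u y (Walk.cons huv (P v y)) ((hP v y).cons hm)
      rw [Walk.edges_cons, List.map_cons, List.sum_cons, hD _ _ _ (hP v y)] at h1
      exact h1.ge
  have hwalk : ∀ (x y z : Fin n) (p : T.Walk x y), D x z ≤ (p.edges.map w).sum + D y z := by
    intro x y z p
    induction p with
    | nil => simp
    | @cons u v t h p ih =>
      rw [Walk.edges_cons, List.map_cons, List.sum_cons]
      have := hcons u v h z
      linarith
  have htri : ∀ x y z, D x z ≤ D x y + D y z := fun x y z => hwalk x y z (P x y)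
  have hmed : ∀ a b c, ∃ m ∈ (P a b).support, D a c = D a m + D m c ∧ D b c = D b m + D m c := by
    intro a b c
    obtain ⟨z, Q, hz, hQ, hQS⟩ := exists_path_first_hit {y | y ∈ (P a b).support} (P c a)
      (Walk.start_mem_support _)
    have hz' : z ∈ (P a b).support := hz
    refine ⟨z, hz', ?_, ?_⟩
    · refine happ a z c ((P a b).takeUntil z hz') Q.reverse ?_
      refine isPath_append_of_disjoint _ _ ((hP a b).takeUntil hz') hQ.reverse ?_
      intro y hy hy'
      rw [Walk.support_reverse, List.mem_reverse] at hy'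
      exact hQS y hy' ((P a b).support_takeUntil_subset_support hz' hy)
    · rw [hsym b c, hsym b z, hsym z c, add_comm]
      refine happ c z b Q ((P a b).dropUntil z hz') ?_
      refine isPath_append_of_disjoint _ _ hQ ((hP a b).dropUntil hz') ?_
      intro y hy hy'
      exact hQS y hy ((P a b).support_dropUntil_subset_support hz' hy')
  refine ⟨D, hD, hsym, ?_⟩
  intro a b c d
  obtain ⟨p, hp, hac, hbc⟩ := hmed a b c
  obtain ⟨q, hq, had, hbd⟩ := hmed a b d
  have h1 := hsplit a b p _ (hP a b) hp
  have h2 := hsplit a b q _ (hP a b) hq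
  have t1 := htri c p d
  have t2 := htri p q d
  have s1 := hsym p b
  have s2 := hsym q b
  have s3 := hsym c p
  have s4 := hsym p q
  rw [← Walk.take_spec (P a b) hp, Walk.mem_support_append_iff] at hq
  rcases hq with hq | hq
  · have h3 := hsplit a p q _ ((hP a b).takeUntil hp) hq
    left; linarith
  · have h3 := hsplit p b q _ ((hP a b).dropUntil hp) hq
    right; linarith

/-- Upper endpoints of the segments. -/
def permTop : Fin 8 → ℤ := ![5, 4, 7, 6, 1, 0, 3, 2]

/-- The join of two copies of `2K₂`. -/
def permG : SimpleGraph (Fin 8) where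
  Adj u v := u ≠ v ∧ ((u.val : ℤ) - (v.val : ℤ)) * (permTop u - permTop v) ≤ 0
  symm := ⟨by
    rintro u v ⟨h, h'⟩
    exact ⟨h.symm, by linarith⟩⟩
  loopless := ⟨fun u h => h.1 rfl⟩

theorem segment_inter_iff (a b c d : ℝ) :
    (segment ℝ ((a, 0) : ℝ × ℝ) ((b, 1) : ℝ × ℝ) ∩
      segment ℝ ((c, 0) : ℝ × ℝ) ((d, 1) : ℝ × ℝ)).Nonempty ↔ (a - c) * (b - d) ≤ 0 := by
  constructor
  · rintro ⟨⟨x, y⟩, ⟨s, t, hs, ht, hst, h⟩, ⟨s', t', hs', ht', hst', h'⟩⟩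
    simp at h h'
    obtain ⟨h1, rfl⟩ := h
    obtain ⟨h2, rfl⟩ := h'
    obtain rfl : s = s' := by linarith
    have h3 : s * (a - c) = - (t' * (b - d)) := by linarith
    by_contra! hcon
    rcases pos_and_pos_or_neg_and_neg_of_mul_pos hcon with ⟨h4, h5⟩ | ⟨h4, h5⟩
    · nlinarith [mul_nonneg hs h4.le, mul_nonneg ht h5.le]
    · nlinarith [mul_nonneg hs (neg_pos.2 h4).le, mul_nonneg ht (neg_pos.2 h5).le]
  · intro h
    have key : ∃ s t : ℝ, 0 ≤ s ∧ 0 ≤ t ∧ s + t = 1 ∧ s * (a - c) + t * (b - d) = 0 := by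
      by_cases hz : (a - c) - (b - d) = 0
      · have : a - c = 0 := by nlinarith [sq_nonneg (a - c)]
        exact ⟨1, 0, by norm_num, by norm_num, by norm_num, by rw [this]; ring⟩
      · have hpos : 0 < ((a - c) - (b - d)) ^ 2 := by positivity
        refine ⟨(-(b - d) * ((a - c) - (b - d))) / ((a - c) - (b - d)) ^ 2,
          ((a - c) * ((a - c) - (b - d))) / ((a - c) - (b - d)) ^ 2, ?_, ?_, ?_, ?_⟩
        · apply div_nonneg _ hpos.le
          nlinarith [sq_nonneg (b - d)]
        · apply div_nonneg _ hpos.le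
          nlinarith [sq_nonneg (a - c)]
        · rw [← add_div, div_eq_one_iff_eq hpos.ne']; ring
        · rw [div_mul_eq_mul_div, div_mul_eq_mul_div, ← add_div, div_eq_zero_iff]
          left; ring
    obtain ⟨s, t, hs, ht, hst, hk⟩ := key
    refine ⟨(s * a + t * b, t), ⟨s, t, hs, ht, hst, by simp⟩, ⟨s, t, hs, ht, hst, ?_⟩⟩
    simp
    linarith

/-- There exists a finite simple graph that is a permutation graph but is not a
pairwise compatibility graph. -/
theorem exists_PermutationGraph_not_PCG :
    ∃ (n : ℕ) (G : SimpleGraph (Fin n)), IsPermutationGraph G ∧ ¬ IsPCG G := by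
  refine ⟨8, permG, ⟨fun u => ((u.val : ℤ) : ℝ), fun u => ((permTop u : ℤ) : ℝ), ?_⟩, ?_⟩
  · intro u v huv
    rw [segment_inter_iff]
    have hcast : ((((u.val : ℤ) : ℝ) - ((v.val : ℤ) : ℝ)) *
        (((permTop u : ℤ) : ℝ) - ((permTop v : ℤ) : ℝ)) ≤ 0) ↔
        (((u.val : ℤ) - (v.val : ℤ)) * (permTop u - permTop v) ≤ 0) := by
      rw [← Int.cast_sub, ← Int.cast_sub, ← Int.cast_mul, Int.cast_nonpos]
    constructor
    · intro h
      exact hcast.2 h.2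
    · intro h
      exact ⟨huv, hcast.1 h⟩
  · rintro ⟨n, T, w, f, dmin, dmax, hc, ha, hw, -, -, -, -, hG⟩
    obtain ⟨D, hD, hsym, h4⟩ := exists_tree_metric T w hc ha hw
    have hE : ∀ u v, permG.Adj u v → dmin ≤ D (f u) (f v) ∧ D (f u) (f v) ≤ dmax := by
      intro u v h
      obtain ⟨p, hp, h'⟩ := (hG u v h.1).1 h
      rwa [hD _ _ p hp] at h'
    have hN : ∀ u v, u ≠ v → ¬ permG.Adj u v → D (f u) (f v) < dmin ∨ dmax < D (f u) (f v) := by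
      intro u v huv h
      by_contra! hcon
      obtain ⟨p⟩ := hc.preconnected (f u) (f v)
      refine h ((hG u v huv).2 ⟨p.bypass, p.bypass_isPath, ?_⟩)
      rwa [hD _ _ _ p.bypass_isPath]
    have hdec : ∀ u v, permG.Adj u v ↔
      (u ≠ v ∧ ((u.val : ℤ) - (v.val : ℤ)) * (permTop u - permTop v) ≤ 0) := fun u v => Iff.rfl
    simp only [hdec] at hE hN
    -- a long non-edge in each block yields an induced four-cycle with two long diagonals
    have hLL : ∀ a c b d : Fin 8, a < 4 → c < 4 → 4 ≤ b → 4 ≤ d →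
        ¬ (dmax < D (f a) (f c) ∧ dmax < D (f b) (f d)) := by
      intro a c b d h1 h2 h3 h4' ⟨hac, hbd⟩
      have key : ∀ u v : Fin 8, u < 4 → 4 ≤ v →
          (u ≠ v ∧ ((u.val : ℤ) - (v.val : ℤ)) * (permTop u - permTop v) ≤ 0) := by decide
      have e1 := (hE a b (key a b h1 h3)).2
      have e2 := (hE a d (key a d h1 h4')).2
      have e3 := (hE c b (key c b h2 h3)).2
      have e4 := (hE c d (key c d h2 h4')).2
      rcases h4 (f a) (f c) (f b) (f d) with h | h <;> linarith
    -- in `2K₂`, some non-edge is long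
    have hlong : ∀ a b c d : Fin 8, dmin ≤ D (f a) (f b) → dmin ≤ D (f c) (f d) →
        (D (f a) (f c) < dmin ∨ dmax < D (f a) (f c)) →
        (D (f b) (f d) < dmin ∨ dmax < D (f b) (f d)) →
        (D (f a) (f d) < dmin ∨ dmax < D (f a) (f d)) →
        (D (f b) (f c) < dmin ∨ dmax < D (f b) (f c)) →
        ∃ x y : Fin 8, (x = a ∨ x = b) ∧ (y = c ∨ y = d) ∧ dmax < D (f x) (f y) := by
      intro a b c d hab hcd hac hbd had hbc
      rcases hac with hac | hac
      · rcases hbd with hbd | hbd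
        · rcases had with had | had
          · rcases hbc with hbc | hbc
            · rcases h4 (f a) (f b) (f c) (f d) with h | h <;> linarith
            · exact ⟨b, c, by simp, by simp, hbc⟩
          · exact ⟨a, d, by simp, by simp, had⟩
        · exact ⟨b, d, by simp, by simp, hbd⟩
      · exact ⟨a, c, by simp, by simp, hac⟩
    obtain ⟨x, y, hx, hy, hxy⟩ := hlong 0 1 2 3 (hE 0 1 (by decide)).1 (hE 2 3 (by decide)).1
      (hN 0 2 (by decide) (by decide)) (hN 1 3 (by decide) (by decide))
      (hN 0 3 (by decide) (by decide)) (hN 1 2 (by decide) (by decide))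
    obtain ⟨z, t, hz, ht, hzt⟩ := hlong 4 5 6 7 (hE 4 5 (by decide)).1 (hE 6 7 (by decide)).1
      (hN 4 6 (by decide) (by decide)) (hN 5 7 (by decide) (by decide))
      (hN 4 7 (by decide) (by decide)) (hN 5 6 (by decide) (by decide))
    refine hLL x y z t ?_ ?_ ?_ ?_ ⟨hxy, hzt⟩
    · rcases hx with rfl | rfl <;> decide
    · rcases hy with rfl | rfl <;> decide
    · rcases hz with rfl | rfl <;> decide
    · rcases ht with rfl | rfl <;> decide
end
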